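/- arXiv:gr-qc/9910034 — 3 statements merged into one kernel-verified Lean document; each statement's English description precedes it below -/
import Mathlib

section
/- Let n ≥ 1, 0 ≤ λ ≤ n, c ∈ ℝ, and let f : ℝⁿ → ℝ be the canonical Morse function f(x) = c − Σ_{i=1}^{λ} x_i² + Σ_{j=λ+1}^{n} x_j², with gradient field η(x) = (−2x₁,…,−2x_λ, 2x_{λ+1},…,2x_n) and explicit flow φ_t(x) = (e^{−2t}x₁,…,e^{−2t}x_λ, e^{2t}x_{λ+1},…,e^{2t}x_n). Let h : ℝⁿ → (n×n real matrices) be continuously differentiable with h(x) symmetric positive definite for every x, and set ξ(x) = h(x)⁻¹·∇f(x). Then for every ε > 0 there exist ε' with 0 < ε' ≤ ε and a continuous injective map Ψ defined on the open ball B(0,ε'), with Ψ(0) = 0, whose image N is an open subset of B(0,ε) and which is a homeomorphism onto N, such that: for every x ∈ B(0,ε') and every t ∈ ℝ with φ_s(x) ∈ B(0,ε') for all s between 0 and t, the curve s ↦ Ψ(φ_s(x)) is differentiable at every s between 0 and t with derivative ξ(Ψ(φ_s(x))). In other words, Ψ is a topological equivalence between the flow of η on B(0,ε') and the flow of ξ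 on N. -/
/-- The open Euclidean ball of radius `r` about the origin in `ℝⁿ`. -/
def euclideanBall (n : ℕ) (r : ℝ) : Set (Fin n → ℝ) :=
  {x | ∑ i : Fin n, x i ^ 2 < r ^ 2}

/-! ### Bounded solutions of scalar linear equations -/

open MeasureTheory Filter Topology Set in
/-- A bounded solution of `w' = μ w + k` is bounded above by `C / μ` when `|k| ≤ C` and `μ > 0`. -/
theorem le_div_of_bounded_of_hasDerivAt {μ C B : ℝ} (hμ : 0 < μ) {w k : ℝ → ℝ}
    (hw : ∀ t, HasDerivAt w (μ * w t + k t) t) (hk : ∀ t, |k t| ≤ C) (hB : ∀ t, |w t| ≤ B)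
    (t : ℝ) : w t ≤ C / μ := by
  have hderiv : ∀ s, HasDerivAt (fun s => Real.exp (-μ * s) * (w s - C / μ))
      (Real.exp (-μ * s) * (k s + C)) s := fun s => by
    have h1 : HasDerivAt (fun s => Real.exp (-μ * s)) (Real.exp (-μ * s) * -μ) s := by
      simpa using ((hasDerivAt_id s).const_mul (-μ)).exp
    refine (h1.fun_mul ((hw s).sub_const (C / μ))).congr_deriv ?_
    field_simp
    ring
  have hmono := monotone_of_hasDerivAt_nonneg hderiv fun s =>
    mul_nonneg (Real.exp_pos _).le (by linarith [neg_abs_le (k s), hk s])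
  have hlim : Tendsto (fun s => Real.exp (-μ * s) * (w s - C / μ)) atTop (𝓝 0) := by
    refine Tendsto.zero_mul_isBoundedUnder_le ?_ ?_
    · exact Real.tendsto_exp_atBot.comp (tendsto_id.const_mul_atTop_of_neg (by linarith))
    · refine isBoundedUnder_of ⟨B + |C / μ|, fun s => ?_⟩
      exact (abs_sub _ _).trans (by gcongr; exact hB s)
  have h0 := hmono.ge_of_tendsto hlim t
  nlinarith [Real.exp_pos (-μ * t)]

/-- A bounded solution of `w' = μ w + k` is bounded by `C / |μ|` when `|k| ≤ C`. -/
theorem abs_le_div_of_bounded_of_hasDerivAt {μ C B : ℝ} (hμ : μ ≠ 0) {w k : ℝ → ℝ}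
    (hw : ∀ t, HasDerivAt w (μ * w t + k t) t) (hk : ∀ t, |k t| ≤ C) (hB : ∀ t, |w t| ≤ B)
    (t : ℝ) : |w t| ≤ C / |μ| := by
  have key : ∀ {μ : ℝ}, 0 < μ → ∀ {w k : ℝ → ℝ}, (∀ t, HasDerivAt w (μ * w t + k t) t) →
      (∀ t, |k t| ≤ C) → (∀ t, |w t| ≤ B) → ∀ t, |w t| ≤ C / μ := by
    intro μ hμ w k hw hk hB t
    refine abs_le'.2 ⟨le_div_of_bounded_of_hasDerivAt hμ hw hk hB t,
      le_div_of_bounded_of_hasDerivAt (w := fun s => -w s) (k := fun s => -k s) (B := B) hμ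
        (fun s => ?_) (by simpa using hk) (by simpa using hB) t⟩
    exact (hw s).fun_neg.congr_deriv (by ring)
  rcases hμ.lt_or_gt with h | h
  · rw [abs_of_neg h]
    have := key (w := fun s => w (-s)) (k := fun s => -k (-s)) (neg_pos.2 h) (fun s => ?_)
      (fun s => by simpa using hk (-s)) (fun s => hB (-s)) (-t)
    · simpa using this
    · exact (HasDerivAt.comp s (hw (-s)) (hasDerivAt_neg s)).congr_deriv (by ring)
  · rw [abs_of_pos h]
    exact key h hw hk hB t

open MeasureTheory Set in
/-- The value at time `0` of the bounded solution of `w' = μ w + k`. -/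
noncomputable def boundedSolution (μ : ℝ) (k : ℝ → ℝ) : ℝ :=
  -Real.sign μ * ∫ r in Ioi (0 : ℝ), Real.exp (-|μ| * r) * k (Real.sign μ * r)

open MeasureTheory Set in
theorem integrableOn_exp_mul_bounded {a C : ℝ} (ha : 0 < a) {k : ℝ → ℝ}
    (hk : Continuous k) (hC : ∀ t, |k t| ≤ C) (x : ℝ) :
    IntegrableOn (fun r => Real.exp (-a * r) * k r) (Ioi x) := by
  refine (exp_neg_integrableOn_Ioi x ha).mul_bdd (c := C) hk.aestronglyMeasurable ?_
  exact Filter.Eventually.of_forall hC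

theorem abs_sign_of_ne_zero {μ : ℝ} (hμ : μ ≠ 0) : |Real.sign μ| = 1 := by
  rcases Real.sign_apply_eq_of_ne_zero μ hμ with h | h <;> simp [h]

open MeasureTheory Set in
theorem abs_boundedSolution_sub_le {μ C : ℝ} (hμ : μ ≠ 0) {k k' : ℝ → ℝ} {B B' : ℝ}
    (hk : Continuous k) (hk' : Continuous k') (hB : ∀ t, |k t| ≤ B) (hB' : ∀ t, |k' t| ≤ B')
    (hC : ∀ t, |k t - k' t| ≤ C) :
    |boundedSolution μ k - boundedSolution μ k'| ≤ C / |μ| := by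
  have hμ' := abs_pos.2 hμ
  rw [boundedSolution, boundedSolution, ← mul_sub, abs_mul, abs_neg, abs_sign_of_ne_zero hμ,
    one_mul, ← integral_sub
      (integrableOn_exp_mul_bounded hμ' (k := fun r => k (Real.sign μ * r))
        (by fun_prop) (fun t => hB _) 0)
      (integrableOn_exp_mul_bounded hμ' (k := fun r => k' (Real.sign μ * r))
        (by fun_prop) (fun t => hB' _) 0)]
  have h1 : ∫ r in Ioi (0 : ℝ), Real.exp (-|μ| * r) * C = C / |μ| := by
    rw [integral_mul_const, integral_exp_mul_Ioi (by linarith)]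
    simp
    field_simp
  rw [← h1, ← Real.norm_eq_abs]
  refine norm_integral_le_of_norm_le ((exp_neg_integrableOn_Ioi 0 hμ').mul_const C) ?_
  refine Filter.Eventually.of_forall fun r => ?_
  rw [← mul_sub, norm_mul, Real.norm_eq_abs, Real.abs_exp]
  gcongr
  exact hC _

theorem boundedSolution_zero (μ : ℝ) : boundedSolution μ (fun _ => 0) = 0 := by
  simp [boundedSolution]

theorem abs_boundedSolution_le {μ C : ℝ} (hμ : μ ≠ 0) {k : ℝ → ℝ} (hk : Continuous k)
    (hC : ∀ t, |k t| ≤ C) : |boundedSolution μ k| ≤ C / |μ| := by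
  simpa [boundedSolution_zero] using
    abs_boundedSolution_sub_le (k' := fun _ => 0) (B' := 0) hμ hk continuous_const hC (by simp)
      (by simpa using hC)

open MeasureTheory Set in
theorem hasDerivAt_boundedSolution_of_pos {μ C : ℝ} (hμ : 0 < μ) {k : ℝ → ℝ} (hk : Continuous k)
    (hC : ∀ t, |k t| ≤ C) (t : ℝ) :
    HasDerivAt (fun t => boundedSolution μ fun s => k (t + s))
      (μ * boundedSolution μ (fun s => k (t + s)) + k t) t := by
  have hint := integrableOn_exp_mul_bounded hμ hk hC
  have hform : ∀ t, boundedSolution μ (fun s => k (t + s)) =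
      -Real.exp (μ * t) * ((∫ r in Ioi (0 : ℝ), Real.exp (-μ * r) * k r) -
        ∫ r in (0 : ℝ)..t, Real.exp (-μ * r) * k r) := by
    intro t
    rw [← intervalIntegral.integral_interval_add_Ioi (hint 0) (hint t), add_sub_cancel_left,
      boundedSolution, Real.sign_of_pos hμ, abs_of_pos hμ]
    have hshift := (measurePreserving_add_right volume t).setIntegral_preimage_emb
      (MeasurableEquiv.addRight t).measurableEmbedding
      (fun r => Real.exp (-μ * r) * k r) (Ioi t)
    have hpre : (fun r => r + t) ⁻¹' Ioi t = Ioi 0 := by ext; simp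
    rw [hpre] at hshift
    rw [← hshift, neg_one_mul, neg_mul, ← integral_const_mul]
    congr 2 with r
    rw [← mul_assoc, ← Real.exp_add, one_mul, add_comm t]
    ring_nf
  have hcont : Continuous fun r => Real.exp (-μ * r) * k r := by fun_prop
  have h1 : HasDerivAt (fun t => -Real.exp (μ * t)) (-(Real.exp (μ * t) * μ)) t := by
    simpa using ((hasDerivAt_id t).const_mul μ).exp.fun_neg
  have h2 := h1.fun_mul ((intervalIntegral.integral_hasDerivAt_right
    (hcont.intervalIntegrable 0 t) (hcont.stronglyMeasurableAtFilter _ _)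
    hcont.continuousAt).const_sub (∫ r in Ioi (0 : ℝ), Real.exp (-μ * r) * k r))
  rw [funext hform]
  refine h2.congr_deriv ?_
  have : Real.exp (μ * t) * Real.exp (-μ * t) = 1 := by rw [← Real.exp_add]; simp
  rw [hform t]
  linear_combination k t * this

theorem hasDerivAt_boundedSolution {μ C : ℝ} (hμ : μ ≠ 0) {k : ℝ → ℝ} (hk : Continuous k)
    (hC : ∀ t, |k t| ≤ C) (t : ℝ) :
    HasDerivAt (fun t => boundedSolution μ fun s => k (t + s))
      (μ * boundedSolution μ (fun s => k (t + s)) + k t) t := by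
  rcases hμ.lt_or_gt with h | h
  · have hrefl : ∀ t, (boundedSolution μ fun s => k (t + s)) =
        boundedSolution (-μ) fun s => -k (-(-t + s)) := by
      intro t
      simp [boundedSolution, Real.sign_of_neg h, Real.sign_of_pos (neg_pos.2 h),
        MeasureTheory.integral_neg, add_comm]
    simp_rw [hrefl]
    refine (HasDerivAt.comp t (hasDerivAt_boundedSolution_of_pos (C := C) (neg_pos.2 h)
      (k := fun s => -k (-s)) (by fun_prop) (fun s => by simpa using hC (-s)) (-t))
      (hasDerivAt_neg t)).congr_deriv ?_
    simp only [neg_neg]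
    ring
  · exact hasDerivAt_boundedSolution_of_pos h hk hC t

open MeasureTheory Set in
theorem continuous_boundedSolution {X : Type*} [TopologicalSpace X] [FirstCountableTopology X]
    {μ C : ℝ} (hμ : μ ≠ 0) {k : X → ℝ → ℝ} (hk : Continuous fun p : X × ℝ => k p.1 p.2)
    (hC : ∀ x t, |k x t| ≤ C) : Continuous fun x => boundedSolution μ (k x) := by
  refine continuous_const.mul (continuous_of_dominated
    (bound := fun r => Real.exp (-|μ| * r) * C) (fun x => ?_) (fun x => ?_) ?_ ?_)
  · have : Continuous (k x) := hk.comp (by fun_prop : Continuous fun s : ℝ => (x, s))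
    exact Continuous.aestronglyMeasurable (by fun_prop)
  · refine Filter.Eventually.of_forall fun r => ?_
    rw [norm_mul, Real.norm_eq_abs, Real.abs_exp]
    gcongr
    exact hC _ _
  · exact (exp_neg_integrableOn_Ioi 0 (abs_pos.2 hμ)).mul_const C
  · refine Filter.Eventually.of_forall fun r => ?_
    exact continuous_const.mul (hk.comp (by fun_prop : Continuous fun x : X => (x, Real.sign μ * r)))

/-! ### Flows of diagonal linear vector fields and their Lipschitz perturbations -/

/-- The flow of the linear vector field `x ↦ (μ i * x i)ᵢ`. -/
noncomputable def diagFlow {ι : Type*} (μ : ι → ℝ) (t : ℝ) (x : ι → ℝ) : ι → ℝ :=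
  fun i => Real.exp (μ i * t) * x i

section DiagFlow

variable {ι : Type*} (μ : ι → ℝ)

@[simp]
theorem diagFlow_zero_left (x : ι → ℝ) : diagFlow μ 0 x = x := by
  ext i
  simp [diagFlow]

@[simp]
theorem diagFlow_zero_right (t : ℝ) : diagFlow μ t 0 = 0 := by
  ext i
  simp [diagFlow]

theorem diagFlow_diagFlow (s t : ℝ) (x : ι → ℝ) :
    diagFlow μ s (diagFlow μ t x) = diagFlow μ (t + s) x := by
  ext i
  simp only [diagFlow]
  rw [mul_add, Real.exp_add]
  ring

theorem continuous_diagFlow : Continuous fun p : ℝ × (ι → ℝ) => diagFlow μ p.1 p.2 := by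
  unfold diagFlow
  fun_prop

theorem hasDerivAt_diagFlow_apply (x : ι → ℝ) (i : ι) (t : ℝ) :
    HasDerivAt (fun t => diagFlow μ t x i) (μ i * diagFlow μ t x i) t := by
  refine ((((hasDerivAt_id t).const_mul (μ i)).exp).mul_const (x i)).congr_deriv ?_
  simp only [diagFlow, id]
  ring

theorem eq_diagFlow_of_hasDerivAt {y : ℝ → ι → ℝ}
    (hy : ∀ t i, HasDerivAt (fun t => y t i) (μ i * y t i) t) (t : ℝ) :
    y t = diagFlow μ t (y 0) := by
  ext i
  have hderiv : ∀ s, HasDerivAt (fun s => Real.exp (-μ i * s) * y s i) 0 s := fun s => by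
    refine ((((hasDerivAt_id s).const_mul (-μ i)).exp).fun_mul (hy s i)).congr_deriv ?_
    simp only [id]
    ring
  have hconst := is_const_of_deriv_eq_zero (fun s => (hderiv s).differentiableAt)
    (fun s => (hderiv s).deriv) t 0
  simp only [mul_zero, Real.exp_zero, one_mul] at hconst
  rw [diagFlow, ← hconst, ← mul_assoc, ← Real.exp_add]
  simp

end DiagFlow

section Perturbation

variable {ι : Type*} [Fintype ι] {μ : ι → ℝ} {m : ℝ} {c : NNReal} {g : (ι → ℝ) → ι → ℝ}

/-- Two solutions of a Lipschitz perturbation of a hyperbolic diagonal system which stay at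
bounded distance for all times coincide. -/
theorem eq_of_dist_bounded_of_hasDerivAt (hμ : ∀ i, m ≤ |μ i|) (hcm : c < m)
    (hg : LipschitzWith c g) {y z : ℝ → ι → ℝ} {B : ℝ}
    (hy : ∀ t i, HasDerivAt (fun t => y t i) (μ i * y t i + g (y t) i) t)
    (hz : ∀ t i, HasDerivAt (fun t => z t i) (μ i * z t i + g (z t) i) t)
    (hB : ∀ t, ‖y t - z t‖ ≤ B) : y = z := by
  have hm : 0 < m := c.coe_nonneg.trans_lt hcm
  have hB0 : 0 ≤ B := (norm_nonneg _).trans (hB 0)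
  have improve : ∀ B, 0 ≤ B → (∀ t, ‖y t - z t‖ ≤ B) → ∀ t, ‖y t - z t‖ ≤ c / m * B := by
    intro B hB0 hB t
    refine (pi_norm_le_iff_of_nonneg (by positivity)).2 fun i => ?_
    have hμi : μ i ≠ 0 := abs_pos.1 (hm.trans_le (hμ i))
    have := abs_le_div_of_bounded_of_hasDerivAt hμi (C := c * B) (B := B)
      (w := fun t => y t i - z t i) (k := fun t => g (y t) i - g (z t) i)
      (fun t => ((hy t i).fun_sub (hz t i)).congr_deriv (by ring))
      (fun t => ?_) (fun t => (norm_le_pi_norm (y t - z t) i).trans (hB t)) t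
    · calc ‖(y t - z t) i‖ ≤ c * B / |μ i| := this
        _ ≤ c * B / m := by gcongr; exact hμ i
        _ = c / m * B := by ring
    · calc |g (y t) i - g (z t) i| ≤ ‖g (y t) - g (z t)‖ :=
            norm_le_pi_norm (g (y t) - g (z t)) i
        _ ≤ c * ‖y t - z t‖ := hg.norm_sub_le _ _
        _ ≤ c * B := by gcongr; exact hB t
  have iter : ∀ (n : ℕ) t, ‖y t - z t‖ ≤ (c / m) ^ n * B := by
    intro n
    induction n with
    | zero => simpa using hB
    | succ n ih =>
      intro t
      refine (improve _ (by positivity) ih t).trans_eq (by ring)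
  ext1 t
  rw [← sub_eq_zero, ← norm_le_zero_iff]
  have hlim := (tendsto_pow_atTop_nhds_zero_of_lt_one (r := c / m) (by positivity)
    ((div_lt_one hm).2 hcm)).mul_const B
  rw [zero_mul] at hlim
  exact ge_of_tendsto' hlim fun n => iter n t

theorem lipschitzWith_diag_add (μ : ι → ℝ) (hg : LipschitzWith c g) :
    LipschitzWith (‖μ‖₊ + c) fun y : ι → ℝ => fun i => μ i * y i + g y i := by
  have h1 : LipschitzWith ‖μ‖₊ fun y : ι → ℝ => μ * y :=
    LipschitzWith.of_dist_le_mul fun a b => by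
      rw [dist_eq_norm, dist_eq_norm, ← mul_sub]
      exact norm_mul_le _ _
  exact h1.add hg

/-- Global existence of solutions for bounded Lipschitz perturbations of a diagonal system. -/
theorem exists_global_solution (μ : ι → ℝ) (hg : LipschitzWith c g) {G : ℝ} (hG : ∀ x, ‖g x‖ ≤ G)
    (x : ι → ℝ) : ∃ y : ℝ → ι → ℝ, y 0 = x ∧
      ∀ t i, HasDerivAt (fun t => y t i) (μ i * y t i + g (y t) i) t := by
  classical
  have hG0 : 0 ≤ G := (norm_nonneg _).trans (hG 0)
  have local_sol : ∀ T : ℝ, 0 < T → ∃ y : ℝ → ι → ℝ, y 0 = x ∧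
      ∀ t ∈ Set.Ioo (-T) T, HasDerivAt y (fun i => μ i * y t i + g (y t) i) t := by
    intro T hT
    set M : ℝ := ‖μ‖
    have hexp : ∀ (i : ι) (s : ℝ), |s| ≤ T → Real.exp (μ i * s) ≤ Real.exp (M * T) := by
      intro i s hs
      rw [Real.exp_le_exp]
      calc μ i * s ≤ |μ i * s| := le_abs_self _
        _ = |μ i| * |s| := abs_mul _ _
        _ ≤ M * T := by
          gcongr
          exact norm_le_pi_norm μ i
    set e : NNReal := ⟨Real.exp (M * T), (Real.exp_pos _).le⟩
    set v : ℝ → (ι → ℝ) → ι → ℝ := fun t z => diagFlow μ (-t) (g (diagFlow μ t z)) with hv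
    have hflow : ∀ s, |s| ≤ T → LipschitzWith e (diagFlow μ s) := by
      intro s hs
      refine LipschitzWith.of_dist_le_mul fun a b => ?_
      refine (dist_pi_le_iff (by positivity)).2 fun i => ?_
      rw [Real.dist_eq, diagFlow, diagFlow, ← mul_sub, abs_mul, Real.abs_exp]
      exact mul_le_mul (hexp i s hs) (dist_le_pi_dist a b i) (abs_nonneg _) e.coe_nonneg
    have hIcc : ∀ t ∈ Set.Icc (-T) T, |t| ≤ T := fun t ht => abs_le.2 ht
    have hPL : IsPicardLindelof v (tmin := -T) (tmax := T) ⟨0, by constructor <;> linarith⟩ x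
        (e * ⟨G, hG0⟩ * ⟨T, hT.le⟩) 0 (e * ⟨G, hG0⟩) (e * (c * e)) := by
      refine ⟨fun t ht => ?_, fun z _ => ?_, fun t ht z _ => ?_, ?_⟩
      · exact (((hflow (-t) (by simpa using hIcc t ht)).comp
          (hg.comp (hflow t (hIcc t ht))))).lipschitzOnWith
      · have h1 := hg.continuous
        have h2 : Continuous fun t => diagFlow μ t z :=
          (continuous_diagFlow μ).comp (by fun_prop : Continuous fun t : ℝ => (t, z))
        exact ((continuous_diagFlow μ).comp
          ((continuous_neg).prodMk (h1.comp h2))).continuousOn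
      · have := (hflow (-t) (by simpa using hIcc t ht)).norm_sub_le (g (diagFlow μ t z)) 0
        rw [diagFlow_zero_right, sub_zero, sub_zero] at this
        exact this.trans (mul_le_mul_of_nonneg_left (hG _) e.coe_nonneg)
      · simp only [sub_zero, zero_sub, neg_neg, max_self, NNReal.coe_zero]
        exact le_rfl
    obtain ⟨z, hz0, hz⟩ := hPL.exists_eq_forall_mem_Icc_hasDerivWithinAt₀
    refine ⟨fun t => diagFlow μ t (z t), by simpa using hz0, fun t ht => ?_⟩
    rw [hasDerivAt_pi]
    intro i
    have h1 := ((hz t (Set.Ioo_subset_Icc_self ht)).hasDerivAt (Icc_mem_nhds ht.1 ht.2))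
    rw [hasDerivAt_pi] at h1
    refine ((((hasDerivAt_id t).const_mul (μ i)).exp).fun_mul (h1 i)).congr_deriv ?_
    simp only [hv, diagFlow, id]
    have : Real.exp (μ i * t) * Real.exp (μ i * -t) = 1 := by rw [← Real.exp_add]; simp
    linear_combination g (diagFlow μ t (z t)) i * this
  have hF := lipschitzWith_diag_add μ hg
  choose! y hy0 hy using local_sol
  have agree : ∀ S T, 0 < S → S ≤ T → ∀ t ∈ Set.Ioo (-S) S, y S t = y T t := by
    intro S T hS hST
    refine ODE_solution_unique_of_mem_Ioo (s := fun _ => Set.univ)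
      (v := fun _ y => fun i => μ i * y i + g y i) (t₀ := 0)
      (fun t _ => hF.lipschitzOnWith) (by constructor <;> linarith)
      (fun t ht => ⟨hy S hS t ht, trivial⟩)
      (fun t ht => ⟨hy T (hS.trans_le hST) t ⟨by linarith [ht.1], by linarith [ht.2]⟩, trivial⟩)
      ?_
    rw [hy0 S hS, hy0 T (hS.trans_le hST)]
  refine ⟨fun t => y (|t| + 1) t, by simpa using hy0 1 one_pos, fun t => ?_⟩
  have hmem : t ∈ Set.Ioo (-(|t| + 1)) (|t| + 1) :=
    ⟨by linarith [neg_abs_le t], by linarith [le_abs_self t]⟩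
  have hev : (fun s => y (|s| + 1) s) =ᶠ[nhds t] y (|t| + 1) := by
    filter_upwards [Ioo_mem_nhds hmem.1 hmem.2] with s hs
    have hs' : s ∈ Set.Ioo (-(|s| + 1)) (|s| + 1) :=
      ⟨by linarith [neg_abs_le s], by linarith [le_abs_self s]⟩
    rcases le_total |s| |t| with h | h
    · exact agree _ _ (by positivity) (by linarith) s hs'
    · exact (agree _ _ (by positivity) (by linarith) s hs).symm
  exact hasDerivAt_pi.1 ((hy (|t| + 1) (by positivity) t hmem).congr_of_eventuallyEq hev)

/-- The displacement of the conjugacy from the identity, as a fixed point of an integral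
operator. -/
theorem exists_conjugacy_displacement (hμ : ∀ i, m ≤ |μ i|) (hcm : c < m)
    (hg : LipschitzWith c g) {G : ℝ} (hG : ∀ x, ‖g x‖ ≤ G) :
    ∃ u : BoundedContinuousFunction (ι → ℝ) (ι → ℝ), ∀ x i,
      u x i = boundedSolution (μ i) fun s => g (diagFlow μ s x + u (diagFlow μ s x)) i := by
  have hm : 0 < m := c.coe_nonneg.trans_lt hcm
  have hG0 : 0 ≤ G := (norm_nonneg _).trans (hG 0)
  have hμ0 : ∀ i, μ i ≠ 0 := fun i => abs_pos.1 (hm.trans_le (hμ i))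
  have hgi : ∀ x i, |g x i| ≤ G := fun x i => (norm_le_pi_norm (g x) i).trans (hG x)
  have hcont : ∀ (u : BoundedContinuousFunction (ι → ℝ) (ι → ℝ)) (i : ι), Continuous
      fun p : (ι → ℝ) × ℝ => g (diagFlow μ p.2 p.1 + u (diagFlow μ p.2 p.1)) i := by
    intro u i
    have h1 : Continuous fun p : (ι → ℝ) × ℝ => diagFlow μ p.2 p.1 :=
      (continuous_diagFlow μ).comp continuous_swap
    exact (continuous_apply i).comp (hg.continuous.comp (h1.add (u.continuous.comp h1)))
  have hcont' : ∀ (u : BoundedContinuousFunction (ι → ℝ) (ι → ℝ)) (i : ι) (x : ι → ℝ), Continuous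
      fun s => g (diagFlow μ s x + u (diagFlow μ s x)) i := fun u i x =>
    (hcont u i).comp (by fun_prop : Continuous fun s : ℝ => (x, s))
  let T : BoundedContinuousFunction (ι → ℝ) (ι → ℝ) → BoundedContinuousFunction (ι → ℝ) (ι → ℝ) :=
    fun u => BoundedContinuousFunction.ofNormedAddCommGroup
      (fun x i => boundedSolution (μ i) fun s => g (diagFlow μ s x + u (diagFlow μ s x)) i)
      (continuous_pi fun i => continuous_boundedSolution (hμ0 i) (hcont u i) fun x t => hgi _ i)
      (G / m) fun x => by
        refine (pi_norm_le_iff_of_nonneg (by positivity)).2 fun i => ?_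
        refine (abs_boundedSolution_le (hμ0 i) (hcont' u i x) fun t => hgi _ i).trans ?_
        gcongr
        exact hμ i
  have hT : ContractingWith (c / m.toNNReal) T := by
    refine ⟨?_, LipschitzWith.of_dist_le_mul fun u v => ?_⟩
    · rw [← NNReal.coe_lt_coe]
      push_cast
      rw [Real.coe_toNNReal _ hm.le]
      exact (div_lt_one hm).2 hcm
    · refine (BoundedContinuousFunction.dist_le (by positivity)).2 fun x => ?_
      refine (dist_pi_le_iff (by positivity)).2 fun i => ?_
      refine (abs_boundedSolution_sub_le (C := c * dist u v) (hμ0 i) (hcont' u i x) (hcont' v i x)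
        (fun t => hgi _ i) (fun t => hgi _ i) fun t => ?_).trans ?_
      · refine (dist_le_pi_dist (g _) (g _) i).trans ((hg.dist_le_mul _ _).trans ?_)
        rw [dist_add_left]
        gcongr
        exact BoundedContinuousFunction.dist_coe_le_dist _
      · push_cast
        rw [Real.coe_toNNReal _ hm.le, div_mul_eq_mul_div]
        gcongr
        exact hμ i
  refine ⟨ContractingWith.fixedPoint T hT, fun x i => ?_⟩
  have hfix := hT.fixedPoint_isFixedPt
  exact congrFun (congrArg (fun u : BoundedContinuousFunction (ι → ℝ) (ι → ℝ) => u x) hfix.symm) i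

/-- **Hartman–Grobman theorem** for bounded perturbations with small Lipschitz constant of a
hyperbolic diagonal linear vector field. -/
theorem exists_homeomorph_conj_diagFlow (hμ : ∀ i, m ≤ |μ i|) (hcm : c < m)
    (hg : LipschitzWith c g) {G : ℝ} (hG : ∀ x, ‖g x‖ ≤ G) (hg0 : g 0 = 0) :
    ∃ H : (ι → ℝ) ≃ₜ (ι → ℝ), H 0 = 0 ∧ ∀ x t i,
      HasDerivAt (fun t => H (diagFlow μ t x) i)
        (μ i * H (diagFlow μ t x) i + g (H (diagFlow μ t x)) i) t := by
  have hm : 0 < m := c.coe_nonneg.trans_lt hcm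
  have hμ0 : ∀ i, μ i ≠ 0 := fun i => abs_pos.1 (hm.trans_le (hμ i))
  have hgi : ∀ x i, |g x i| ≤ G := fun x i => (norm_le_pi_norm (g x) i).trans (hG x)
  obtain ⟨u, hu⟩ := exists_conjugacy_displacement hμ hcm hg hG
  set Ψ : (ι → ℝ) → ι → ℝ := fun x => x + u x with hΨ
  have hΨc : Continuous Ψ := continuous_id.add u.continuous
  have hΨsub : ∀ x, ‖Ψ x - x‖ ≤ ‖u‖ := fun x => by
    simpa [hΨ] using u.norm_coe_le_norm x
  have hcurve : ∀ x, Continuous fun s => diagFlow μ s x := fun x =>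
    (continuous_diagFlow μ).comp (by fun_prop : Continuous fun t : ℝ => (t, x))
  have hsol : ∀ x t i, HasDerivAt (fun t => Ψ (diagFlow μ t x) i)
      (μ i * Ψ (diagFlow μ t x) i + g (Ψ (diagFlow μ t x)) i) t := by
    intro x t i
    have hform : ∀ t, u (diagFlow μ t x) i =
        boundedSolution (μ i) fun s => g (Ψ (diagFlow μ (t + s) x)) i := by
      intro t
      rw [hu]
      simp only [diagFlow_diagFlow, hΨ]
    have h1 := hasDerivAt_boundedSolution (hμ0 i) (C := G)
      (k := fun s => g (Ψ (diagFlow μ s x)) i)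
      ((continuous_apply i).comp (hg.continuous.comp (hΨc.comp (hcurve x)))) (fun t => hgi _ i) t
    simp only [← hform] at h1
    refine ((hasDerivAt_diagFlow_apply μ x i t).fun_add h1).congr_deriv ?_
    simp only [hΨ, Pi.add_apply]
    ring
  have hinj : Function.Injective Ψ := by
    intro x x' hxx
    have heq := ODE_solution_unique_univ (v := fun _ y => fun i => μ i * y i + g y i)
      (f := fun t => Ψ (diagFlow μ t x)) (g := fun t => Ψ (diagFlow μ t x'))
      (s := fun _ => Set.univ) (t₀ := 0) (fun _ => (lipschitzWith_diag_add μ hg).lipschitzOnWith)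
      (fun t => ⟨hasDerivAt_pi.2 (hsol x t), trivial⟩)
      (fun t => ⟨hasDerivAt_pi.2 (hsol x' t), trivial⟩) (by simpa using hxx)
    have hlin := eq_of_dist_bounded_of_hasDerivAt (g := fun _ => 0) (c := 0) (B := 2 * ‖u‖) hμ
      (by simpa using hm) (LipschitzWith.const' 0)
      (y := fun t => diagFlow μ t x) (z := fun t => diagFlow μ t x')
      (fun t i => by simpa using hasDerivAt_diagFlow_apply μ x i t)
      (fun t i => by simpa using hasDerivAt_diagFlow_apply μ x' i t) fun t => ?_
    · simpa using congrFun hlin 0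
    · have h3 : Ψ (diagFlow μ t x) = Ψ (diagFlow μ t x') := congrFun heq t
      have h1 := hΨsub (diagFlow μ t x)
      have h2 := hΨsub (diagFlow μ t x')
      calc ‖diagFlow μ t x - diagFlow μ t x'‖
          = ‖(Ψ (diagFlow μ t x') - diagFlow μ t x') - (Ψ (diagFlow μ t x) - diagFlow μ t x)‖ := by
            rw [h3]
            congr 1
            abel
        _ ≤ ‖u‖ + ‖u‖ := (norm_sub_le _ _).trans (add_le_add h2 h1)
        _ = 2 * ‖u‖ := by ring
  have hsurj : Function.Surjective Ψ := by
    intro y₀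
    obtain ⟨y, hy0, hy⟩ := exists_global_solution μ hg hG y₀
    have hyc : Continuous y := continuous_pi fun i =>
      continuous_iff_continuousAt.2 fun t => (hy t i).continuousAt
    have hkc : ∀ i, Continuous fun s => g (y s) i := fun i =>
      (continuous_apply i).comp (hg.continuous.comp hyc)
    set v : ℝ → ι → ℝ := fun t i => boundedSolution (μ i) fun s => g (y (t + s)) i with hv
    have hvd : ∀ t i, HasDerivAt (fun t => v t i) (μ i * v t i + g (y t) i) t := fun t i =>
      hasDerivAt_boundedSolution (hμ0 i) (hkc i) (fun t => hgi _ i) t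
    have hvb : ∀ t, ‖v t‖ ≤ G / m := by
      intro t
      have hG0 : 0 ≤ G := (norm_nonneg _).trans (hG 0)
      refine (pi_norm_le_iff_of_nonneg (by positivity)).2 fun i => ?_
      refine (abs_boundedSolution_le (hμ0 i) ((hkc i).comp (by fun_prop)) fun t => hgi _ i).trans ?_
      gcongr
      exact hμ i
    have hlin := eq_diagFlow_of_hasDerivAt μ (y := fun t => y t - v t) fun t i =>
      ((hy t i).fun_sub (hvd t i)).congr_deriv (by simp only [Pi.sub_apply]; ring)
    refine ⟨y 0 - v 0, ?_⟩
    have heq := eq_of_dist_bounded_of_hasDerivAt (B := ‖u‖ + G / m) hμ hcm hg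
      (hsol (y 0 - v 0)) hy fun t => ?_
    · simpa [hy0] using congrFun heq 0
    · rw [← hlin t]
      calc ‖Ψ (y t - v t) - y t‖ = ‖(Ψ (y t - v t) - (y t - v t)) - v t‖ := by
            congr 1
            abel
        _ ≤ ‖u‖ + G / m := (norm_sub_le _ _).trans (add_le_add (hΨsub _) (hvb t))
  have hproper : IsProperMap Ψ := by
    refine isProperMap_iff_tendsto_cocompact.2 ⟨hΨc, ?_⟩
    rw [← Metric.cobounded_eq_cocompact, ← tendsto_norm_atTop_iff_cobounded]
    refine Filter.tendsto_atTop_mono (f := fun x => ‖x‖ - ‖u‖) (fun x => ?_)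
      (Filter.tendsto_atTop_add_const_right _ _ tendsto_norm_cobounded_atTop)
    have := norm_sub_norm_le x (x - Ψ x)
    rw [sub_sub_cancel, norm_sub_rev] at this
    linarith [hΨsub x]
  refine ⟨(Equiv.ofBijective Ψ ⟨hinj, hsurj⟩).toHomeomorphOfContinuousClosed hΨc
    hproper.isClosedMap, ?_, hsol⟩
  have heq := eq_of_dist_bounded_of_hasDerivAt (B := ‖Ψ 0‖) hμ hcm hg (hsol 0)
    (z := fun _ => 0) (fun t i => by simpa [hg0] using hasDerivAt_const t (0 : ℝ))
    fun t => by simp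
  have h0 : Ψ 0 = 0 := by simpa using congrFun heq 0
  exact h0

end Perturbation

/-! ### Topological conjugacy of diagonal linear flows -/

/-- The odd extension of `x ↦ x ^ a` to the real line. -/
noncomputable def signedPow (a x : ℝ) : ℝ := Real.sign x * |x| ^ a

theorem signedPow_mul (a : ℝ) {r : ℝ} (hr : 0 < r) (x : ℝ) :
    signedPow a (r * x) = r ^ a * signedPow a x := by
  have hs : Real.sign (r * x) = Real.sign x := by
    rcases lt_trichotomy x 0 with h | h | h
    · rw [Real.sign_of_neg h, Real.sign_of_neg (mul_neg_of_pos_of_neg hr h)]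
    · simp [h]
    · rw [Real.sign_of_pos h, Real.sign_of_pos (mul_pos hr h)]
  rw [signedPow, signedPow, hs, abs_mul, abs_of_pos hr, Real.mul_rpow hr.le (abs_nonneg _)]
  ring

theorem signedPow_of_nonneg {a : ℝ} (ha : 0 < a) {x : ℝ} (hx : 0 ≤ x) :
    signedPow a x = x ^ a := by
  rcases hx.eq_or_lt with rfl | h
  · simp [signedPow, Real.zero_rpow ha.ne']
  · rw [signedPow, Real.sign_of_pos h, abs_of_pos h, one_mul]

theorem signedPow_of_nonpos {a : ℝ} (ha : 0 < a) {x : ℝ} (hx : x ≤ 0) :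
    signedPow a x = -(-x) ^ a := by
  rcases hx.eq_or_lt with rfl | h
  · simp [signedPow, Real.zero_rpow ha.ne']
  · rw [signedPow, Real.sign_of_neg h, abs_of_neg h, neg_one_mul]

theorem continuous_signedPow {a : ℝ} (ha : 0 < a) : Continuous (signedPow a) := by
  have h : signedPow a = fun x => if x ≤ 0 then -(-x) ^ a else x ^ a := by
    ext x
    split_ifs with hx
    · exact signedPow_of_nonpos ha hx
    · exact signedPow_of_nonneg ha (not_le.1 hx).le
  rw [h]
  refine Continuous.if_le ?_ ?_ continuous_id continuous_const fun x hx => ?_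
  · exact ((Real.continuous_rpow_const ha.le).comp continuous_neg).neg
  · exact Real.continuous_rpow_const ha.le
  · simp [hx, Real.zero_rpow ha.ne']

theorem signedPow_signedPow {a b : ℝ} (ha : 0 < a) (hb : 0 < b) (hab : a * b = 1) (x : ℝ) :
    signedPow b (signedPow a x) = x := by
  rcases le_total 0 x with h | h
  · rw [signedPow_of_nonneg ha h, signedPow_of_nonneg hb (by positivity), ← Real.rpow_mul h, hab,
      Real.rpow_one]
  · have h' : 0 ≤ -x := by linarith
    rw [signedPow_of_nonpos ha h,
      signedPow_of_nonpos hb (neg_nonpos.2 (Real.rpow_nonneg h' a)), neg_neg,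
      ← Real.rpow_mul h', hab, Real.rpow_one, neg_neg]

/-- The odd extension of `x ↦ x ^ a`, as a homeomorphism of the real line. -/
noncomputable def signedPowHomeomorph (a : ℝ) (ha : 0 < a) : ℝ ≃ₜ ℝ where
  toFun := signedPow a
  invFun := signedPow a⁻¹
  left_inv := signedPow_signedPow ha (inv_pos.2 ha) (mul_inv_cancel₀ ha.ne')
  right_inv := signedPow_signedPow (inv_pos.2 ha) ha (inv_mul_cancel₀ ha.ne')
  continuous_toFun := continuous_signedPow ha
  continuous_invFun := continuous_signedPow (inv_pos.2 ha)

/-- Diagonal linear flows whose rates have pairwise equal signs are topologically conjugate. -/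
theorem exists_homeomorph_diagFlow {ι : Type*} {μ d : ι → ℝ} (h : ∀ i, 0 < μ i / d i) :
    ∃ E : (ι → ℝ) ≃ₜ (ι → ℝ), E 0 = 0 ∧
      ∀ t x, E (diagFlow d t x) = diagFlow μ t (E x) := by
  refine ⟨Homeomorph.piCongrRight fun i => signedPowHomeomorph (μ i / d i) (h i), ?_, ?_⟩
  · ext i
    simp [signedPowHomeomorph, signedPow]
  · intro t x
    ext i
    have hd : d i ≠ 0 := fun hd => by simpa [hd] using h i
    change signedPow (μ i / d i) (Real.exp (d i * t) * x i) =
      Real.exp (μ i * t) * signedPow (μ i / d i) (x i)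
    rw [signedPow_mul _ (Real.exp_pos _), ← Real.exp_mul]
    congr 2
    field_simp

/-! ### Simultaneous diagonalization -/

open Matrix in
/-- **Sylvester's law of inertia** for two congruent diagonal matrices. -/
theorem ncard_neg_eq_of_congruent_diagonal {ι : Type*} [Fintype ι] [DecidableEq ι] {d μ : ι → ℝ}
    {P : Matrix ι ι ℝ} (hP : IsUnit P) (h : Pᵀ * diagonal d * P = diagonal μ) :
    {i | μ i < 0}.ncard = {i | d i < 0}.ncard := by
  have hsum : ∀ (w v : ι → ℝ), QuadraticMap.weightedSumSquares ℝ w v = v ⬝ᵥ (diagonal w *ᵥ v) := by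
    intro w v
    simp only [QuadraticMap.weightedSumSquares_apply, smul_eq_mul, dotProduct, mulVec_diagonal]
    exact Finset.sum_congr rfl fun i _ => by ring
  let e : (QuadraticMap.weightedSumSquares ℝ μ).IsometryEquiv
      (QuadraticMap.weightedSumSquares ℝ d) :=
    { LinearEquiv.ofBijective P.mulVecLin
        ⟨mulVec_injective_of_isUnit hP, mulVec_surjective_iff_isUnit.2 hP⟩ with
      map_app' := fun v => by
        change QuadraticMap.weightedSumSquares ℝ d (P *ᵥ v) = _
        rw [hsum, hsum, ← h, ← mulVec_mulVec, ← mulVec_mulVec, dotProduct_mulVec v,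
          vecMul_transpose] }
  rw [← QuadraticForm.sigNeg_of_equiv_weightedSumSquares ⟨e⟩,
    QuadraticForm.sigNeg_weightedSumSquares]

open Matrix in
open scoped MatrixOrder Matrix.Norms.L2Operator in
theorem Matrix.PosDef.exists_eq_transpose_mul_self {ι : Type*} [Fintype ι] [DecidableEq ι]
    {K : Matrix ι ι ℝ} (hK : K.PosDef) : ∃ y : Matrix ι ι ℝ, IsUnit y ∧ K = yᵀ * y := by
  obtain ⟨y, hy, h⟩ :=
    CStarAlgebra.isStrictlyPositive_iff_eq_star_mul_self.1 hK.isStrictlyPositive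
  exact ⟨y, hy, by rw [h, star_eq_conjTranspose, conjTranspose_eq_transpose_of_trivial]⟩

theorem exists_perm_neg_iff {ι : Type*} [Fintype ι] {d μ : ι → ℝ}
    (h : {i | μ i < 0}.ncard = {i | d i < 0}.ncard) :
    ∃ σ : Equiv.Perm ι, ∀ i, μ (σ i) < 0 ↔ d i < 0 := by
  classical
  have hcard : Fintype.card {i // d i < 0} = Fintype.card {i // μ i < 0} := by
    rw [← Nat.card_eq_fintype_card, ← Nat.card_eq_fintype_card]
    exact h.symm
  let e := Fintype.equivOfCardEq hcard
  refine ⟨e.extendSubtype, fun i => ⟨fun hi => ?_, fun hi => e.extendSubtype_mem i hi⟩⟩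
  by_contra hd
  exact e.extendSubtype_not_mem i hd hi

open Matrix in
/-- The product of a positive definite matrix with a diagonal matrix of nonzero entries is
diagonalizable over the reals, with the same number of negative eigenvalues. -/
theorem Matrix.PosDef.exists_diagonalization_mul_diagonal {ι : Type*} [Fintype ι] [DecidableEq ι]
    {K : Matrix ι ι ℝ} (hK : K.PosDef) {d : ι → ℝ} (hd : ∀ i, d i ≠ 0) :
    ∃ (P : Matrix ι ι ℝ) (μ : ι → ℝ), IsUnit P ∧ K * diagonal d * P = P * diagonal μ ∧
      ∀ i, 0 < μ i / d i := by
  obtain ⟨y, hy, rfl⟩ := hK.exists_eq_transpose_mul_self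
  have hS : (y * diagonal d * yᵀ).IsHermitian := by
    simp [IsHermitian, conjTranspose_eq_transpose_of_trivial, Matrix.mul_assoc]
  set U : Matrix ι ι ℝ := (hS.eigenvectorUnitary).1 with hU
  set ν : ι → ℝ := hS.eigenvalues with hν
  have hUU : Uᵀ * U = 1 := by
    have := Unitary.coe_star_mul_self hS.eigenvectorUnitary
    rwa [star_eq_conjTranspose, conjTranspose_eq_transpose_of_trivial] at this
  have hUU' : U * Uᵀ = 1 := mul_eq_one_comm.1 hUU
  have hspec : y * diagonal d * yᵀ = U * diagonal ν * Uᵀ := by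
    have := hS.spectral_theorem
    rw [Unitary.conjStarAlgAut_apply, star_eq_conjTranspose,
      conjTranspose_eq_transpose_of_trivial] at this
    exact this
  have hUunit : IsUnit U := IsUnit.of_mul_eq_one _ hUU'
  have hyT : IsUnit yᵀ := (isUnit_transpose y).2 hy
  have hQ : IsUnit (yᵀ * U) := hyT.mul hUunit
  have hcongr : (yᵀ * U)ᵀ * diagonal d * (yᵀ * U) = diagonal ν := by
    calc (yᵀ * U)ᵀ * diagonal d * (yᵀ * U) = Uᵀ * (y * diagonal d * yᵀ) * U := by
          simp only [transpose_mul, transpose_transpose, Matrix.mul_assoc]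
      _ = (Uᵀ * U) * diagonal ν * (Uᵀ * U) := by rw [hspec]; simp only [Matrix.mul_assoc]
      _ = diagonal ν := by simp [hUU]
  have hν0 : ∀ i, ν i ≠ 0 := by
    have h1 : IsUnit (diagonal ν) := by
      rw [← hcongr]
      exact (((isUnit_transpose _).2 hQ).mul
        (isUnit_diagonal.2 (Pi.isUnit_iff.2 fun i => (hd i).isUnit))).mul hQ
    exact fun i => (Pi.isUnit_iff.1 (isUnit_diagonal.1 h1) i).ne_zero
  have hdiag : yᵀ * y * diagonal d * (yᵀ * U) = yᵀ * U * diagonal ν := by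
    calc yᵀ * y * diagonal d * (yᵀ * U) = yᵀ * (y * diagonal d * yᵀ) * U := by
          simp only [Matrix.mul_assoc]
      _ = yᵀ * U * diagonal ν * (Uᵀ * U) := by rw [hspec]; simp only [Matrix.mul_assoc]
      _ = yᵀ * U * diagonal ν := by simp [hUU]
  obtain ⟨σ, hσ⟩ := exists_perm_neg_iff (ncard_neg_eq_of_congruent_diagonal hQ hcongr)
  refine ⟨(yᵀ * U).submatrix id σ, ν ∘ σ, ?_, ?_, fun i => ?_⟩
  · exact (isUnit_submatrix_equiv (A := yᵀ * U) (Equiv.refl ι) σ).2 hQ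
  · ext i j
    have := congrFun (congrFun hdiag i) (σ j)
    rw [mul_diagonal] at this ⊢
    rw [← submatrix_id_id (yᵀ * y * diagonal d)]
    simpa [Matrix.mul_apply] using this
  · rcases (hd i).lt_or_gt with h | h
    · exact div_pos_of_neg_of_neg ((hσ i).2 h) h
    · refine div_pos (lt_of_le_of_ne (not_lt.1 fun h' => ?_) (hν0 _).symm) h
      exact lt_asymm h ((hσ i).1 h')

/-! ### Smoothness of the matrix inverse -/

theorem Matrix.contDiff_det {E ι : Type*} [NormedAddCommGroup E] [NormedSpace ℝ E] [Fintype ι]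
    [DecidableEq ι] {k : WithTop ℕ∞} {M : E → Matrix ι ι ℝ}
    (hM : ∀ i j, ContDiff ℝ k fun x => M x i j) : ContDiff ℝ k fun x => (M x).det := by
  simp only [Matrix.det_apply]
  exact ContDiff.sum fun σ _ => (contDiff_prod fun i _ => hM _ _).const_smul _

theorem Matrix.contDiff_inv {E ι : Type*} [NormedAddCommGroup E] [NormedSpace ℝ E] [Fintype ι]
    [DecidableEq ι] {k : WithTop ℕ∞} {M : E → Matrix ι ι ℝ}
    (hM : ∀ i j, ContDiff ℝ k fun x => M x i j) (hdet : ∀ x, (M x).det ≠ 0) (i j : ι) :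
    ContDiff ℝ k fun x => (M x)⁻¹ i j := by
  simp only [Matrix.inv_def, Ring.inverse_eq_inv', Matrix.smul_apply, smul_eq_mul,
    Matrix.adjugate_apply]
  refine ((Matrix.contDiff_det hM).inv hdet).mul (Matrix.contDiff_det fun a b => ?_)
  by_cases h : a = j
  · simpa [Matrix.updateRow_apply, h] using contDiff_const
  · simpa [Matrix.updateRow_apply, h] using hM a b

/-! ### Linearization at the origin -/

open Matrix in
theorem hasStrictFDerivAt_mulVec_diagonal_zero {ι : Type*} [Fintype ι] [DecidableEq ι]
    {B : (ι → ℝ) → Matrix ι ι ℝ} (hB : ∀ i j, ContDiff ℝ 1 fun x => B x i j) (d : ι → ℝ) :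
    HasStrictFDerivAt (fun x => B x *ᵥ fun i => d i * x i)
      (LinearMap.toContinuousLinearMap (B 0 * diagonal d).mulVecLin) 0 := by
  rw [hasStrictFDerivAt_pi']
  intro i
  have h : ∀ j ∈ Finset.univ, HasStrictFDerivAt (fun x : ι → ℝ => B x i j * (d j * x j)) _ 0 :=
    fun j _ => ((hB i j).contDiffAt.hasStrictFDerivAt one_ne_zero).mul
      ((ContinuousLinearMap.proj (R := ℝ) (φ := fun _ : ι => ℝ) j).hasStrictFDerivAt.const_mul
        (d j))
  refine (HasStrictFDerivAt.fun_sum h).congr_fderiv ?_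
  ext1 v
  simp [mulVec, dotProduct, mul_assoc]

/-- Near a zero, a strictly differentiable map agrees with the sum of its derivative and of a
bounded globally Lipschitz map with small constant. -/
theorem HasStrictFDerivAt.exists_lipschitzWith_remainder {ι : Type*} [Fintype ι]
    {F : (ι → ℝ) → ι → ℝ} {L : (ι → ℝ) →L[ℝ] ι → ℝ} (hF : HasStrictFDerivAt F L 0)
    (hF0 : F 0 = 0) {c : NNReal} (hc : 0 < c) :
    ∃ δ > 0, ∃ g : (ι → ℝ) → ι → ℝ, LipschitzWith c g ∧ (∃ G : ℝ, ∀ x, ‖g x‖ ≤ G) ∧ g 0 = 0 ∧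
      ∀ y, ‖y‖ ≤ δ → F y = L y + g y := by
  obtain ⟨s, hs, happ⟩ := hF.approximates_deriv_on_nhds (Or.inr hc)
  obtain ⟨δ, hδ, hδs⟩ := Metric.nhds_basis_closedBall.mem_iff.1 hs
  let r : (ι → ℝ) → ι → ℝ := fun y i => max (-δ) (min δ (y i))
  have hr : ∀ y, ‖r y‖ ≤ δ := fun y => (pi_norm_le_iff_of_nonneg hδ.le).2 fun i =>
    abs_le.2 ⟨le_max_left _ _, max_le (by linarith) (min_le_left _ _)⟩
  have hrid : ∀ y, ‖y‖ ≤ δ → r y = y := fun y hy => by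
    ext i
    have := abs_le.1 ((norm_le_pi_norm y i).trans hy)
    simp [r, this.1, this.2]
  have hrlip : LipschitzWith 1 r := LipschitzWith.of_dist_le_mul fun x y => by
    rw [NNReal.coe_one, one_mul, dist_pi_le_iff dist_nonneg]
    intro i
    refine le_trans ?_ (dist_le_pi_dist x y i)
    refine (abs_max_sub_max_le_max _ _ _ _).trans ?_
    rw [sub_self, abs_zero, max_eq_right (abs_nonneg _)]
    refine (abs_min_sub_min_le_max _ _ _ _).trans ?_
    rw [sub_self, abs_zero, max_eq_right (abs_nonneg _), Real.dist_eq]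
  have hmem : ∀ y, r y ∈ s := fun y => hδs (by simpa using hr y)
  have hr0 : r 0 = 0 := hrid 0 (by simpa using hδ.le)
  have hdist : ∀ x y, ‖(F (r x) - L (r x)) - (F (r y) - L (r y))‖ ≤ c * ‖r x - r y‖ := fun x y => by
    have h := happ _ (hmem x) _ (hmem y)
    rwa [map_sub, sub_sub_sub_comm] at h
  refine ⟨δ, hδ, fun y => F (r y) - L (r y), ?_, ⟨c * δ, fun x => ?_⟩, ?_, fun y hy => ?_⟩
  · refine LipschitzWith.of_dist_le_mul fun x y => ?_
    rw [dist_eq_norm]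
    refine (hdist x y).trans (mul_le_mul_of_nonneg_left ?_ c.2)
    simpa [dist_eq_norm] using hrlip.dist_le_mul x y
  · have h := hdist x 0
    rw [hr0, hF0, map_zero, sub_zero, sub_zero, sub_zero] at h
    exact h.trans (mul_le_mul_of_nonneg_left (hr x) c.2)
  · simp [hr0, hF0]
  · simp [hrid y hy]

theorem exists_pos_le_abs {ι : Type*} [Finite ι] {μ : ι → ℝ} (h : ∀ i, μ i ≠ 0) :
    ∃ m > 0, ∀ i, m ≤ |μ i| := by
  cases isEmpty_or_nonempty ι
  · exact ⟨1, one_pos, isEmptyElim⟩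
  · obtain ⟨i, hi⟩ := Finite.exists_min fun i => |μ i|
    exact ⟨|μ i|, abs_pos.2 (h i), hi⟩

theorem isOpen_euclideanBall (n : ℕ) (r : ℝ) : IsOpen (euclideanBall n r) :=
  isOpen_lt (by fun_prop) continuous_const

theorem zero_mem_euclideanBall (n : ℕ) {r : ℝ} (hr : 0 < r) : 0 ∈ euclideanBall n r := by
  simpa [euclideanBall] using pow_pos hr 2

theorem norm_lt_of_mem_euclideanBall {n : ℕ} {r : ℝ} (hr : 0 < r) {x : Fin n → ℝ}
    (hx : x ∈ euclideanBall n r) : ‖x‖ < r := by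
  refine (pi_norm_lt_iff hr).2 fun i => ?_
  have h : x i ^ 2 ≤ ∑ j, x j ^ 2 :=
    Finset.single_le_sum (f := fun j => x j ^ 2) (fun j _ => sq_nonneg _) (Finset.mem_univ i)
  exact abs_lt_of_sq_lt_sq (h.trans_lt hx) hr.le

open Matrix in
/-- The vector field `B(x) (d • x)` with `B(0)` positive definite is conjugate near the origin
to the linear vector field `d • x`, by a homeomorphism of the whole space. -/
theorem exists_homeomorph_integralCurve {ι : Type*} [Fintype ι] [DecidableEq ι]
    {B : (ι → ℝ) → Matrix ι ι ℝ} (hB : ∀ i j, ContDiff ℝ 1 fun x => B x i j)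
    (hB0 : (B 0).PosDef) {d : ι → ℝ} (hd : ∀ i, d i ≠ 0) :
    ∃ Ψ : (ι → ℝ) ≃ₜ (ι → ℝ), Ψ 0 = 0 ∧ ∃ V ∈ nhds (0 : ι → ℝ), ∀ x t, diagFlow d t x ∈ V →
      HasDerivAt (fun s => Ψ (diagFlow d s x))
        (B (Ψ (diagFlow d t x)) *ᵥ fun i => d i * Ψ (diagFlow d t x) i) t := by
  obtain ⟨P, μ, hP, hPμ, hμd⟩ := hB0.exists_diagonalization_mul_diagonal hd
  have hμ : ∀ i, μ i ≠ 0 := fun i hi => by simpa [hi] using hμd i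
  obtain ⟨m, hm, hmμ⟩ := exists_pos_le_abs hμ
  have hPP : P⁻¹ * P = 1 := nonsing_inv_mul _ ((isUnit_iff_isUnit_det _).1 hP)
  have hPP' : P * P⁻¹ = 1 := mul_nonsing_inv _ ((isUnit_iff_isUnit_det _).1 hP)
  let X : (ι → ℝ) → ι → ℝ := fun x => B x *ᵥ fun i => d i * x i
  let LP := LinearMap.toContinuousLinearMap P.mulVecLin
  let LP' := LinearMap.toContinuousLinearMap (P⁻¹).mulVecLin
  let T : (ι → ℝ) ≃ₜ (ι → ℝ) :=
    { toFun := LP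
      invFun := LP'
      left_inv := fun x => by simp [LP, LP', hPP]
      right_inv := fun x => by simp [LP, LP', hPP']
      continuous_toFun := LP.continuous
      continuous_invFun := LP'.continuous }
  have hF : HasStrictFDerivAt (fun y => LP' (X (LP y)))
      (LinearMap.toContinuousLinearMap (diagonal μ).mulVecLin) 0 := by
    have hX : HasStrictFDerivAt X
        (LinearMap.toContinuousLinearMap (B 0 * diagonal d).mulVecLin) (LP 0) := by
      rw [map_zero]
      exact hasStrictFDerivAt_mulVec_diagonal_zero hB d
    refine (LP'.hasStrictFDerivAt.comp 0 (hX.comp 0 LP.hasStrictFDerivAt)).congr_fderiv ?_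
    ext1 v
    simp only [LP, LP', ContinuousLinearMap.comp_apply, LinearMap.coe_toContinuousLinearMap',
      mulVecLin_apply, mulVec_mulVec]
    rw [hPμ, ← Matrix.mul_assoc, hPP, Matrix.one_mul]
  lift m to NNReal using hm.le
  obtain ⟨δ, hδ, g, hg, ⟨G, hG⟩, hg0, hFg⟩ := hF.exists_lipschitzWith_remainder
    (by simp [X, ← Pi.zero_def]) (c := m / 2) (half_pos (NNReal.coe_pos.1 hm))
  obtain ⟨H, hH0, hH⟩ := exists_homeomorph_conj_diagFlow hmμ (by simpa using hm) hg hG hg0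
  obtain ⟨E, hE0, hE⟩ := exists_homeomorph_diagFlow hμd
  refine ⟨(E.trans H).trans T, by simp [T, hE0, hH0], (E.trans H) ⁻¹' Metric.closedBall 0 δ,
    (E.trans H).continuous.continuousAt.preimage_mem_nhds ?_, fun x t hxt => ?_⟩
  · simpa [hE0, hH0] using Metric.closedBall_mem_nhds _ hδ
  · have hy : ‖H (diagFlow μ t (E x))‖ ≤ δ := by simpa [hE] using hxt
    have h1 : HasDerivAt (fun s => H (diagFlow μ s (E x)))
        (LP' (X (LP (H (diagFlow μ t (E x)))))) t := by
      rw [hasDerivAt_pi]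
      intro i
      rw [hFg _ hy]
      simpa [mulVec_diagonal] using hH (E x) t i
    have h2 := LP.hasFDerivAt.comp_hasDerivAt t h1
    have h3 : LP (LP' (X (LP (H (diagFlow μ t (E x)))))) = X (LP (H (diagFlow μ t (E x)))) :=
      T.apply_symm_apply _
    rw [h3] at h2
    simpa [T, hE, X, Function.comp_def] using h2

/-- Lemma 1 (topeq.lemma): near the critical point, the flow of the timelike vector field
`ξ = h⁻¹·∇f` of a Morse geometry is topologically equivalent to the explicit flow `φ` of
the gradient field `η` of the canonical Morse function
`f(x) = c − Σ_{i<λ} x_i² + Σ_{i≥λ} x_i²`: for every `ε > 0` there are `0 < ε' ≤ ε` and a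
homeomorphism `Ψ` of the ball `B(0,ε')` onto an open subset `N ⊆ B(0,ε)` fixing the
origin which carries the flow `φ` in `B(0,ε')` onto integral curves of `ξ` in `N`. -/
theorem stmt6 (n l : ℕ) (hn : 1 ≤ n) (hl : l ≤ n) (c : ℝ)
    (f : (Fin n → ℝ) → ℝ)
    (hf : ∀ x, f x = c + ∑ i : Fin n, (if (i : ℕ) < l then -(x i ^ 2) else x i ^ 2))
    (η : (Fin n → ℝ) → (Fin n → ℝ))
    (hη : ∀ x i, η x i = if (i : ℕ) < l then -2 * x i else 2 * x i)
    (φ : ℝ → (Fin n → ℝ) → (Fin n → ℝ))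
    (hφ : ∀ t x i, φ t x i =
      (if (i : ℕ) < l then Real.exp (-2 * t) else Real.exp (2 * t)) * x i)
    (h : (Fin n → ℝ) → Matrix (Fin n) (Fin n) ℝ)
    (hsmooth : ∀ i j, ContDiff ℝ 1 fun x => h x i j)
    (hpos : ∀ x, (h x).PosDef)
    (ξ : (Fin n → ℝ) → (Fin n → ℝ))
    (hξ : ∀ x, ξ x = Matrix.mulVec (h x)⁻¹ (η x)) :
    ∀ ε > (0 : ℝ), ∃ ε' : ℝ, 0 < ε' ∧ ε' ≤ ε ∧
      ∃ (Ψ Φ : (Fin n → ℝ) → (Fin n → ℝ)) (N : Set (Fin n → ℝ)),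
        N = Ψ '' euclideanBall n ε' ∧
        IsOpen N ∧ N ⊆ euclideanBall n ε ∧
        Ψ 0 = 0 ∧
        -- `Ψ` is a homeomorphism of `B(0,ε')` onto `N`, with inverse `Φ`:
        ContinuousOn Ψ (euclideanBall n ε') ∧ Set.BijOn Ψ (euclideanBall n ε') N ∧
        ContinuousOn Φ N ∧ Set.InvOn Φ Ψ (euclideanBall n ε') N ∧
        -- `Ψ` carries the flow of `η` in `B(0,ε')` onto integral curves of `ξ` in `N`:
        (∀ x ∈ euclideanBall n ε', ∀ t : ℝ,
          (∀ s ∈ Set.uIcc (0 : ℝ) t, φ s x ∈ euclideanBall n ε') →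
          ∀ s ∈ Set.uIcc (0 : ℝ) t,
            HasDerivAt (fun r : ℝ => Ψ (φ r x)) (ξ (Ψ (φ s x))) s) := by
  intro ε hε
  set d : Fin n → ℝ := fun i => if (i : ℕ) < l then -2 else 2 with hd
  have hφd : ∀ t x, φ t x = diagFlow d t x := fun t x => by
    ext i
    rw [hφ]
    by_cases hi : (i : ℕ) < l <;> simp [diagFlow, hd, hi]
  have hξd : ∀ x, ξ x = Matrix.mulVec (h x)⁻¹ fun i => d i * x i := fun x => by
    rw [hξ]
    congr 1
    ext i
    rw [hη]
    by_cases hi : (i : ℕ) < l <;> simp [hd, hi]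
  have hd0 : ∀ i, d i ≠ 0 := fun i => by
    by_cases hi : (i : ℕ) < l <;> simp [hd, hi]
  obtain ⟨Ψ, hΨ0, V, hV, hΨ⟩ := exists_homeomorph_integralCurve (B := fun x => (h x)⁻¹)
    (Matrix.contDiff_inv hsmooth fun x => (hpos x).det_pos.ne') (hpos 0).inv hd0
  have hU : V ∩ Ψ ⁻¹' euclideanBall n ε ∈ nhds 0 := Filter.inter_mem hV <|
    Ψ.continuous.continuousAt.preimage_mem_nhds <| (isOpen_euclideanBall n ε).mem_nhds <| by
      rw [hΨ0]
      exact zero_mem_euclideanBall n hε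
  obtain ⟨r, hr, hrU⟩ := Metric.mem_nhds_iff.1 hU
  have hε' : 0 < min ε r := lt_min hε hr
  have hsub : ∀ x ∈ euclideanBall n (min ε r), x ∈ V ∩ Ψ ⁻¹' euclideanBall n ε := fun x hx =>
    hrU (mem_ball_zero_iff.2 ((norm_lt_of_mem_euclideanBall hε' hx).trans_le (min_le_right _ _)))
  refine ⟨min ε r, hε', min_le_left _ _, Ψ, Ψ.symm, _, rfl,
    Ψ.isOpenMap _ (isOpen_euclideanBall n _), ?_, hΨ0, Ψ.continuous.continuousOn,
    Ψ.injective.injOn.bijOn_image, Ψ.symm.continuous.continuousOn,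
    ⟨fun x _ => Ψ.symm_apply_apply x, fun x _ => Ψ.apply_symm_apply x⟩, ?_⟩
  · rintro _ ⟨x, hx, rfl⟩
    exact (hsub x hx).2
  · intro x _ t ht s hs
    have hxs := ht s hs
    simp only [hφd, hξd] at hxs ⊢
    exact hΨ x s (hsub _ hxs).1
end

section
/- Let M be a topological space with a chronology relation ≪ satisfying: (i) ≪ is transitive; (ii) for every x ∈ M the sets I⁺(x) = {y : x ≪ y} and I⁻(x) = {y : y ≪ x} are open; (iii) whenever x ≪ z, every neighbourhood of x contains a point y with x ≪ y and y ≪ z, and every neighbourhood of z contains a point y with x ≪ y and y ≪ z. Let U ⊆ M be open. Then for every y ∈ U, the common past relative to U of I⁺(y) ∩ U equals the common past of I⁺(y) intersected with U; that is, int{q ∈ U : q ≪ s for all s ∈ I⁺(y) ∩ U} = int{q ∈ M : q ≪ s for all s ∈ I⁺(y)} ∩ U. -/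
/-- Claim 4 (IUcap.claim): let `M` be a topological space with a chronology relation `≪`
which is transitive, has open chronological futures `I⁺(x) = {y | x ≪ y}` and pasts
`I⁻(x) = {y | y ≪ x}`, and is such that whenever `x ≪ z`, every neighbourhood of `x` and
every neighbourhood of `z` contains a point `y` with `x ≪ y ≪ z`.  Then for every open
`U ⊆ M` and every `y ∈ U`, the common past relative to `U` of `I⁺(y) ∩ U` equals the
trace on `U` of the common past of `I⁺(y)`:
`int{q ∈ U | q ≪ s ∀ s ∈ I⁺(y) ∩ U} = int{q | q ≪ s ∀ s ∈ I⁺(y)} ∩ U`. -/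
theorem stmt14 {M : Type*} [TopologicalSpace M] (lt : M → M → Prop)
    (htrans : Transitive lt)
    (hopenFut : ∀ x : M, IsOpen {y | lt x y})
    (hopenPast : ∀ x : M, IsOpen {y | lt y x})
    (hdense : ∀ x z : M, lt x z →
      (∀ V ∈ nhds x, ∃ y ∈ V, lt x y ∧ lt y z) ∧
      (∀ V ∈ nhds z, ∃ y ∈ V, lt x y ∧ lt y z))
    (U : Set M) (hU : IsOpen U) :
    ∀ y ∈ U,
      interior {q | q ∈ U ∧ ∀ s, lt y s → s ∈ U → lt q s} =
        interior {q | ∀ s, lt y s → lt q s} ∩ U := by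
  intro y hy
  rw [← hU.interior_eq, ← interior_inter, hU.interior_eq]
  congr 1
  ext q
  refine ⟨fun ⟨hq, h⟩ => ⟨fun s hs => ?_, hq⟩, fun ⟨h, hq⟩ => ⟨hq, fun s hs _ => h s hs⟩⟩
  obtain ⟨t, htU, hyt, hts⟩ := (hdense y s hs).1 U (hU.mem_nhds hy)
  exact htrans (h t hyt htU) hts
end

section
/- Let M be a topological space with a chronology relation ≪ satisfying: (i) ≪ is transitive; (ii) for every x ∈ M the sets I⁺(x) = {y : x ≪ y} and I⁻(x) = {y : y ≪ x} are open; (iii) whenever x ≪ z, every neighbourhood of x contains a point y with x ≪ y and y ≪ z, and every neighbourhood of z contains a point y with x ≪ y and y ≪ z. Let U ⊆ M be open and let x, y ∈ U. If x ∈ int{q ∈ U : q ≪ s for all s ∈ I⁺(y) ∩ U} and ¬(x ≪ y), then x ∈ int{q ∈ M : q ≪ s for all s ∈ I⁺(y)} and ¬(x ≪ y); dually, if y ∈ int{q ∈ U : s ≪ q for all s ∈ I⁻(x) ∩ U} and ¬(x ≪ y), then y ∈ int{q ∈ M : s ≪ q for all s ∈ I⁻(x)} and ¬(x ≪ y). In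 other words, if the open subspacetime U is causally discontinuous at a pair of its points, then M is causally discontinuous at that same pair. -/
/-- Claim 5 (IUcapcd.claim): let `M` be a topological space with a chronology relation
`≪` which is transitive, has open chronological futures `I⁺(x) = {y | x ≪ y}` and pasts
`I⁻(x) = {y | y ≪ x}`, and is such that whenever `x ≪ z`, every neighbourhood of `x` and
every neighbourhood of `z` contains a point `y` with `x ≪ y ≪ z`.  Let `U ⊆ M` be open
and `x, y ∈ U`.  If `x` lies in the common past relative to `U` of `I⁺(y) ∩ U` but
`¬(x ≪ y)`, then `x` lies in the common past of `I⁺(y)` in `M` and `¬(x ≪ y)`; dually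
for the common future.  That is, causal discontinuity of the open subspacetime `U` at a
pair of its points implies causal discontinuity of `M` at that same pair. -/
theorem stmt15 {M : Type*} [TopologicalSpace M] (lt : M → M → Prop)
    (htrans : Transitive lt)
    (hopenFut : ∀ x : M, IsOpen {y | lt x y})
    (hopenPast : ∀ x : M, IsOpen {y | lt y x})
    (hdense : ∀ x z : M, lt x z →
      (∀ V ∈ nhds x, ∃ y ∈ V, lt x y ∧ lt y z) ∧
      (∀ V ∈ nhds z, ∃ y ∈ V, lt x y ∧ lt y z))
    (U : Set M) (hU : IsOpen U) (x y : M) (hx : x ∈ U) (hy : y ∈ U) :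
    (x ∈ interior {q | q ∈ U ∧ ∀ s, lt y s → s ∈ U → lt q s} → ¬ lt x y →
      x ∈ interior {q | ∀ s, lt y s → lt q s} ∧ ¬ lt x y) ∧
    (y ∈ interior {q | q ∈ U ∧ ∀ s, lt s x → s ∈ U → lt s q} → ¬ lt x y →
      y ∈ interior {q | ∀ s, lt s x → lt s q} ∧ ¬ lt x y) := by
  refine ⟨fun h hxy => ⟨interior_mono ?_ h, hxy⟩, fun h hxy => ⟨interior_mono ?_ h, hxy⟩⟩
  · rintro q ⟨-, hq⟩ s hys
    obtain ⟨w, hwU, hyw, hws⟩ := (hdense y s hys).1 U (hU.mem_nhds hy)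
    exact htrans (hq w hyw hwU) hws
  · rintro q ⟨-, hq⟩ s hsx
    obtain ⟨w, hwU, hsw, hwx⟩ := (hdense s x hsx).2 U (hU.mem_nhds hx)
    exact htrans hsw (hq w hwx hwU)
end
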